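/- Periodic measures are dense among shift-invariant measures on the cylinder topology: for every shift-invariant Borel probability measure ν on {0,1}^ℕ, every k ∈ ℕ, and every ε > 0, there exist a point x ∈ {0,1}^ℕ and a positive integer p with σ^p(x) = x, such that |(1/p) · #{ 0 ≤ i ≤ p−1 : σ^i(x) ∈ C } − ν(C)| < ε for every cylinder C with domain contained in {0, 1, …, k−1}. -/

import Mathlib

open MeasureTheory Filter
open scoped Classical

/-- The left shift on `{0,1}^ℕ` (modelled as `ℕ → Bool`). -/
def binShift : (ℕ → Bool) → (ℕ → Bool) := fun ω n => ω (n + 1)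

/-- By the strong law of large numbers, finitely many integrals against a probability measure
can be approximated simultaneously by averages over finitely many points. -/
theorem exists_average_close_integral {Ω ι : Type*} [MeasurableSpace Ω] [Finite ι]
    (μ : Measure Ω) [IsProbabilityMeasure μ] (f : ι → Ω → ℝ) (hf : ∀ i, Measurable (f i))
    (hint : ∀ i, Integrable (f i) μ) {δ : ℝ} (hδ : 0 < δ) :
    ∃ (M : ℕ) (y : ℕ → Ω), 1 ≤ M ∧
      ∀ i, |(∑ j ∈ Finset.range M, f i (y j)) / M - ∫ ω, f i ω ∂μ| < δ := by
  let P : Measure (ℕ → Ω) := Measure.infinitePi fun _ => μ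
  have hev (j : ℕ) : MeasurePreserving (fun y : ℕ → Ω => y j) P μ :=
    measurePreserving_eval_infinitePi _ j
  have key (i : ι) : ∀ᵐ y ∂P, Tendsto
      (fun n : ℕ => (∑ j ∈ Finset.range n, f i (y j)) / n) atTop (nhds (∫ ω, f i ω ∂μ)) := by
    have hident (j : ℕ) : ProbabilityTheory.IdentDistrib (fun y : ℕ → Ω => f i (y j))
        (fun y => f i (y 0)) P P := by
      refine ⟨((hf i).comp (hev j).measurable).aemeasurable,
        ((hf i).comp (hev 0).measurable).aemeasurable, ?_⟩
      change Measure.map (f i ∘ fun y : ℕ → Ω => y j) P = Measure.map (f i ∘ fun y : ℕ → Ω => y 0) P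
      rw [← Measure.map_map (hf i) (hev j).measurable, ← Measure.map_map (hf i) (hev 0).measurable,
        (hev j).map_eq, (hev 0).map_eq]
    have hindep : ProbabilityTheory.iIndepFun (fun (j : ℕ) (y : ℕ → Ω) => f i (y j)) P :=
      ProbabilityTheory.iIndepFun_infinitePi (X := fun _ => f i) fun _ => hf i
    have hlaw := ProbabilityTheory.strong_law_ae_real (fun j (y : ℕ → Ω) => f i (y j))
      ((hev 0).integrable_comp_of_integrable (hint i)) (fun a b hab => hindep.indepFun hab) hident
    have hmean : ∫ y, f i (y 0) ∂P = ∫ ω, f i ω ∂μ := by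
      rw [← (hev 0).map_eq, integral_map (hev 0).measurable.aemeasurable
        (hf i).aestronglyMeasurable]
    rwa [hmean] at hlaw
  obtain ⟨y, hy⟩ := (ae_all_iff.2 key).exists
  have hclose : ∀ᶠ n : ℕ in atTop, ∀ i,
      |(∑ j ∈ Finset.range n, f i (y j)) / n - ∫ ω, f i ω ∂μ| < δ :=
    eventually_all.2 fun i => (hy i).eventually (Metric.ball_mem_nhds _ hδ)
  obtain ⟨M, hM, hM1⟩ := (hclose.and (eventually_ge_atTop 1)).exists
  exact ⟨M, y, hM1, hM⟩

theorem Finset.sum_range_mul_eq_sum_sum {A : Type*} [AddCommMonoid A] (f : ℕ → A) (m n : ℕ) :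
    ∑ i ∈ Finset.range (m * n), f i =
      ∑ j ∈ Finset.range m, ∑ a ∈ Finset.range n, f (j * n + a) := by
  induction m with
  | zero => simp
  | succ m ih => rw [Nat.succ_mul, Finset.sum_range_add, ih, Finset.sum_range_succ]

theorem binShift_iterate_apply (i n : ℕ) (ω : ℕ → Bool) : binShift^[i] ω n = ω (n + i) := by
  induction i generalizing ω with
  | zero => rfl
  | succ i ih =>
    rw [Function.iterate_succ_apply, ih]
    simp only [binShift]
    congr 1

/-- The periodic sequence obtained by repeating the word `y 0 … y (M - 1)` formed of the initial
blocks of length `N` of the sequences `y j`. -/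
def periodicConcat (N M : ℕ) (y : ℕ → ℕ → Bool) : ℕ → Bool := fun n => y (n / N % M) (n % N)

theorem binShift_iterate_periodicConcat {N : ℕ} (hN : 0 < N) (M : ℕ) (y : ℕ → ℕ → Bool) :
    binShift^[M * N] (periodicConcat N M y) = periodicConcat N M y := by
  funext n
  simp [binShift_iterate_apply, periodicConcat, Nat.add_mul_div_right _ _ hN]

theorem periodicConcat_apply {N M j b : ℕ} (y : ℕ → ℕ → Bool) (hb : b < N) (hj : j < M) :
    periodicConcat N M y (j * N + b) = y j b := by
  have hN : 0 < N := by omega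
  simp [periodicConcat, Nat.mod_eq_of_lt hj, Nat.mod_eq_of_lt hb, Nat.add_comm (j * N),
    Nat.add_mul_div_right _ _ hN, Nat.div_eq_of_lt hb]

/-- The union of cylinders on the first `k` coordinates prescribed by a set of words. -/
def wordCylinder {k : ℕ} (S : Set (Fin k → Bool)) : Set (ℕ → Bool) :=
  {ω | (fun l : Fin k => ω l) ∈ S}

theorem measurableSet_wordCylinder {k : ℕ} (S : Set (Fin k → Bool)) :
    MeasurableSet (wordCylinder S) :=
  (measurable_pi_lambda _ fun l : Fin k => measurable_pi_apply (l : ℕ)) S.toFinite.measurableSet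

theorem integral_sum_indicator_iterate {Ω : Type*} [MeasurableSpace Ω] {μ : Measure Ω}
    [IsFiniteMeasure μ] {T : Ω → Ω} (hT : MeasurePreserving T μ μ) {C : Set Ω}
    (hC : MeasurableSet C) (N : ℕ) :
    ∫ ω, ∑ a ∈ Finset.range N, C.indicator (1 : Ω → ℝ) (T^[a] ω) ∂μ = N * μ.real C := by
  have hi : Integrable (C.indicator (1 : Ω → ℝ)) μ := (integrable_const 1).indicator hC
  have hia (a : ℕ) : Integrable (fun ω => C.indicator (1 : Ω → ℝ) (T^[a] ω)) μ :=
    (hT.iterate a).integrable_comp_of_integrable hi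
  rw [integral_finsetSum _ fun a _ => hia a]
  have (a : ℕ) : ∫ ω, C.indicator (1 : Ω → ℝ) (T^[a] ω) ∂μ = μ.real C := by
    rw [← integral_indicator_one hC]
    conv_rhs => rw [← (hT.iterate a).map_eq]
    rw [integral_map (hT.iterate a).measurable.aemeasurable
      (measurable_one.indicator hC).aestronglyMeasurable]
  simp [this]

/-- Within one block, visits of `periodicConcat` to a word cylinder differ from those of the
underlying sequence only at the last `k` positions. -/
theorem abs_sum_indicator_periodicConcat_sub_le {k L M j : ℕ} (y : ℕ → ℕ → Bool) (hj : j < M)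
    (S : Set (Fin k → Bool)) :
    |∑ a ∈ Finset.range (L + k), (wordCylinder S).indicator (1 : (ℕ → Bool) → ℝ)
        (binShift^[j * (L + k) + a] (periodicConcat (L + k) M y)) -
      ∑ a ∈ Finset.range (L + k), (wordCylinder S).indicator (1 : (ℕ → Bool) → ℝ)
        (binShift^[a] (y j))| ≤ k := by
  have hmem (a : ℕ) (ha : a < L) :
      binShift^[j * (L + k) + a] (periodicConcat (L + k) M y) ∈ wordCylinder S ↔
        binShift^[a] (y j) ∈ wordCylinder S := by
    simp only [wordCylinder, Set.mem_ofPred_eq, binShift_iterate_apply]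
    have (l : Fin k) : periodicConcat (L + k) M y (l + (j * (L + k) + a)) = y j (l + a) := by
      rw [← periodicConcat_apply (N := L + k) y (by omega) hj]
      congr 1
      ring
    simp only [this]
  rw [← Finset.sum_sub_distrib, Finset.sum_range_add, Finset.sum_eq_zero, zero_add]
  · refine (Finset.abs_sum_le_sum_abs _ _).trans ((Finset.sum_le_card_nsmul _ _ 1 ?_).trans ?_)
    · intro a _
      simp only [Set.indicator_apply, Pi.one_apply]
      split_ifs <;> simp
    · simp
  · intro a ha
    simp [Set.indicator_apply, hmem a (Finset.mem_range.1 ha)]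

/-- Periodic measures are dense among shift-invariant measures in the cylinder topology:
for every shift-invariant Borel probability measure `ν` on `{0,1}^ℕ`, every `k ∈ ℕ` and
`ε > 0`, there are a point `x` and a period `p ≥ 1` with `σ^p x = x` such that the
empirical averages of `x` over one period are `ε`-close to `ν` on every cylinder with
domain contained in `{0, …, k-1}`. -/
theorem periodic_measures_dense (ν : Measure (ℕ → Bool)) [IsProbabilityMeasure ν]
    (hν : MeasurePreserving binShift ν ν) (k : ℕ) (ε : ℝ) (hε : 0 < ε) :
    ∃ (x : ℕ → Bool) (p : ℕ), 1 ≤ p ∧ binShift^[p] x = x ∧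
      ∀ (r : ℕ) (n : Fin r → ℕ) (iv : Fin r → Bool), (∀ j : Fin r, n j < k) →
        |(((Finset.range p).filter
              (fun i => binShift^[i] x ∈ {ω : ℕ → Bool | ∀ j : Fin r, ω (n j) = iv j})).card : ℝ) / p -
            (ν {ω : ℕ → Bool | ∀ j : Fin r, ω (n j) = iv j}).toReal| < ε := by
  obtain ⟨L, hL⟩ := exists_nat_gt (2 * k / ε)
  set N := L + k
  have hL0 : 0 < L := by
    have : (0 : ℝ) < L := lt_of_le_of_lt (by positivity) hL
    exact_mod_cast this
  have hN : 0 < N := by omega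
  have hNR : (0 : ℝ) < N := by exact_mod_cast hN
  have hkN : (k : ℝ) < N * (ε / 2) := by
    rw [div_lt_iff₀ hε] at hL
    have : (L : ℝ) * ε ≤ N * ε := by gcongr; omega
    linarith
  have hmeas (S : Set (Fin k → Bool)) :
      Measurable ((wordCylinder S).indicator (1 : (ℕ → Bool) → ℝ)) :=
    measurable_one.indicator (measurableSet_wordCylinder S)
  obtain ⟨M, y, hM, hy⟩ := exists_average_close_integral ν
    (fun (S : Set (Fin k → Bool)) ω =>
      ∑ a ∈ Finset.range N, (wordCylinder S).indicator (1 : (ℕ → Bool) → ℝ) (binShift^[a] ω))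
    (fun S => Finset.measurable_sum _ fun a _ => (hmeas S).comp (hν.iterate a).measurable)
    (fun S => integrable_finsetSum _ fun a _ => (hν.iterate a).integrable_comp_of_integrable
      ((integrable_const 1).indicator (measurableSet_wordCylinder S)))
    (δ := N * (ε / 2)) (by positivity)
  have hMR : (0 : ℝ) < M := by exact_mod_cast hM
  refine ⟨periodicConcat N M y, M * N, Nat.mul_pos hM hN,
    binShift_iterate_periodicConcat hN M y, fun r n iv hn => ?_⟩
  let S : Set (Fin k → Bool) := {u | ∀ j : Fin r, u ⟨n j, hn j⟩ = iv j}
  have hcyl : {ω : ℕ → Bool | ∀ j : Fin r, ω (n j) = iv j} = wordCylinder S := by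
    ext ω
    simp [wordCylinder, S]
  suffices |(((Finset.range (M * N)).filter
    (fun i => binShift^[i] (periodicConcat N M y) ∈ wordCylinder S)).card : ℝ) / (M * N : ℕ) -
      ν.real (wordCylinder S)| < ε by
    simpa only [hcyl, Measure.real] using this
  have hcard : (((Finset.range (M * N)).filter
      (fun i => binShift^[i] (periodicConcat N M y) ∈ wordCylinder S)).card : ℝ) =
      ∑ j ∈ Finset.range M, ∑ a ∈ Finset.range N, (wordCylinder S).indicator
        (1 : (ℕ → Bool) → ℝ) (binShift^[j * N + a] (periodicConcat N M y)) := by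
    rw [← Finset.sum_range_mul_eq_sum_sum fun i => (wordCylinder S).indicator
      (1 : (ℕ → Bool) → ℝ) (binShift^[i] (periodicConcat N M y))]
    simp [Set.indicator_apply]
  have hS := hy S
  rw [integral_sum_indicator_iterate hν (measurableSet_wordCylinder S)] at hS
  rw [hcard]
  set A := ∑ j ∈ Finset.range M, ∑ a ∈ Finset.range N, (wordCylinder S).indicator
    (1 : (ℕ → Bool) → ℝ) (binShift^[j * N + a] (periodicConcat N M y))
  set B := ∑ j ∈ Finset.range M, ∑ a ∈ Finset.range N, (wordCylinder S).indicator
    (1 : (ℕ → Bool) → ℝ) (binShift^[a] (y j))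
  have hAB : |A - B| ≤ M * k := by
    rw [← Finset.sum_sub_distrib]
    refine (Finset.abs_sum_le_sum_abs _ _).trans ((Finset.sum_le_card_nsmul _ _ (k : ℝ)
      fun j hj => abs_sum_indicator_periodicConcat_sub_le y (Finset.mem_range.1 hj) S).trans ?_)
    simp
  have hABM : |A / M - B / M| ≤ k := by
    rw [← sub_div, abs_div, abs_of_pos hMR, div_le_iff₀ hMR]
    linarith
  have hA : |A / M - N * ν.real (wordCylinder S)| < N * ε := by
    linarith [abs_sub_le (A / M) (B / M) (N * ν.real (wordCylinder S))]
  have hfactor : A / (M * N : ℕ) - ν.real (wordCylinder S) =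
      (A / M - N * ν.real (wordCylinder S)) / N := by
    push_cast
    field_simp
  rw [hfactor, abs_div, abs_of_pos hNR, div_lt_iff₀ hNR]
  linarith
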